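/- (1/2)∫_0^∞ (1 − ρ₁(t)²)·t dt = ζ(3), where ρ₁(t) is the Erdős–Rényi giant-component function: ρ₁(t) = 0 for t ≤ 1 and ρ₁(t) is the unique positive root of ρ = 1 − e^{−tρ} for t > 1. -/

import Mathlib

open MeasureTheory

lemma mul_one_sub_exp_neg_lt {a x : ℝ} (ha : 0 < a) (hax : a < x) :
    a * (1 - Real.exp (-x)) < x * (1 - Real.exp (-a)) := by
  have hx : 0 < x := ha.trans hax
  have h := strictConvexOn_exp.2 (Set.mem_univ (-x)) (Set.mem_univ 0) (by linarith)
    (show 0 < a / x by positivity) (show 0 < 1 - a / x by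
      have : a / x < 1 := (div_lt_one hx).2 hax
      linarith) (by ring)
  simp only [smul_eq_mul, mul_zero, add_zero, Real.exp_zero, mul_one] at h
  have h1 : a / x * -x = -a := by field_simp
  rw [h1] at h
  have h2 := mul_lt_mul_of_pos_left h hx
  have h3 : x * (a / x * Real.exp (-x) + (1 - a / x)) = a * Real.exp (-x) + (x - a) := by
    field_simp
  rw [h3] at h2
  linarith

lemma mul_one_sub_exp_neg_lt_iff {a x : ℝ} (ha : 0 < a) (hx : 0 < x) :
    a * (1 - Real.exp (-x)) < x * (1 - Real.exp (-a)) ↔ a < x := by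
  refine ⟨fun h => ?_, mul_one_sub_exp_neg_lt ha⟩
  by_contra! hxa
  rcases hxa.eq_or_lt with rfl | hxa
  · exact lt_irrefl _ h
  · exact lt_asymm h (mul_one_sub_exp_neg_lt hx hxa)

lemma one_sub_exp_neg_pos {x : ℝ} (hx : 0 < x) : 0 < 1 - Real.exp (-x) := by
  have : Real.exp (-x) < 1 := Real.exp_lt_one_iff.2 (by linarith)
  linarith

/-- The exponential parametrization of the giant-component function inverts
`x ↦ x / (1 - e^{-x})`. -/
lemma exists_giantComponent_eq_one_sub_exp_neg {ρ : ℝ → ℝ}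
    (hzero : ∀ t : ℝ, t ≤ 1 → ρ t = 0) (hpos : ∀ t : ℝ, 1 < t → 0 < ρ t)
    (hfix : ∀ t : ℝ, 1 < t → ρ t = 1 - Real.exp (-(t * ρ t))) (t : ℝ) :
    ∃ a : ℝ, 0 ≤ a ∧ ρ t = 1 - Real.exp (-a) ∧
      ∀ x : ℝ, 0 < x → (t * (1 - Real.exp (-x)) < x ↔ a < x) := by
  rcases le_or_gt t 1 with ht | ht
  · refine ⟨0, le_rfl, by simp [hzero t ht], fun x hx => ⟨fun _ => hx, fun _ => ?_⟩⟩
    have h1 := one_sub_exp_neg_pos hx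
    have h2 := Real.add_one_lt_exp (show -x ≠ 0 by linarith)
    nlinarith
  · have hρ := hpos t ht
    have ha : 0 < t * ρ t := by positivity
    refine ⟨t * ρ t, ha.le, hfix t ht, fun x hx => ?_⟩
    rw [← mul_one_sub_exp_neg_lt_iff ha hx, ← hfix t ht, ← mul_lt_mul_iff_left₀ hρ]
    ring_nf

lemma measurable_giantComponent {ρ : ℝ → ℝ}
    (hparam : ∀ t : ℝ, ∃ a : ℝ, 0 ≤ a ∧ ρ t = 1 - Real.exp (-a) ∧
      ∀ x : ℝ, 0 < x → (t * (1 - Real.exp (-x)) < x ↔ a < x)) : Measurable ρ := by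
  refine measurable_of_Iio fun c => ?_
  rcases le_or_gt c 0 with hc | hc
  · convert MeasurableSet.empty using 1
    ext t
    obtain ⟨a, ha, h, -⟩ := hparam t
    have : Real.exp (-a) ≤ 1 := Real.exp_le_one_iff.2 (by linarith)
    simp only [Set.mem_preimage, Set.mem_Iio, Set.mem_empty_iff_false, iff_false, not_lt]
    linarith
  rcases le_or_gt 1 c with hc1 | hc1
  · convert MeasurableSet.univ using 1
    ext t
    obtain ⟨a, ha, h, -⟩ := hparam t
    have := Real.exp_pos (-a)
    simp only [Set.mem_preimage, Set.mem_Iio, Set.mem_univ, iff_true]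
    linarith
  · have hlog : Real.log (1 - c) < 0 := Real.log_neg (by linarith) (by linarith)
    have hexp : Real.exp (- -Real.log (1 - c)) = 1 - c := by
      rw [neg_neg, Real.exp_log (by linarith)]
    convert measurableSet_lt (measurable_id.mul_const c)
      (measurable_const (a := -Real.log (1 - c))) using 1
    ext t
    obtain ⟨a, ha, h, hx⟩ := hparam t
    have hx := hx (-Real.log (1 - c)) (by linarith)
    rw [hexp, sub_sub_cancel] at hx
    simp only [Set.mem_preimage, Set.mem_Iio, Set.mem_ofPred_eq, id, hx, h]
    rw [lt_neg, Real.log_lt_iff_lt_exp (by linarith)]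
    constructor <;> intro <;> linarith

lemma lintegral_Ioi_one_sub_exp_neg_mul_exp_neg {a t : ℝ} (ha : 0 ≤ a) (ht : 0 ≤ t) :
    ∫⁻ x in Set.Ioi a, ENNReal.ofReal (2 * t * ((1 - Real.exp (-x)) * Real.exp (-x)))
      = ENNReal.ofReal ((1 - (1 - Real.exp (-a)) ^ 2) * t) := by
  have hderiv : ∀ x ∈ Set.Ici a, HasDerivAt (fun x => t * (1 - Real.exp (-x)) ^ 2)
      (2 * t * ((1 - Real.exp (-x)) * Real.exp (-x))) x := by
    intro x _
    have h : HasDerivAt (fun x => 1 - Real.exp (-x)) (Real.exp (-x)) x := by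
      simpa using (hasDerivAt_neg x).exp.const_sub 1
    exact ((h.fun_pow 2).const_mul t).congr_deriv (by push_cast; ring)
  have hnonneg : ∀ x ∈ Set.Ioi a,
      0 ≤ 2 * t * ((1 - Real.exp (-x)) * Real.exp (-x)) := by
    intro x hx
    have := one_sub_exp_neg_pos (ha.trans_lt hx)
    positivity
  have hlim : Filter.Tendsto (fun x => t * (1 - Real.exp (-x)) ^ 2) Filter.atTop
      (nhds (t * (1 - 0) ^ 2)) :=
    ((tendsto_const_nhds.sub Real.tendsto_exp_neg_atTop_nhds_zero).pow 2).const_mul t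
  rw [← ofReal_integral_eq_lintegral_ofReal
    (integrableOn_Ioi_deriv_of_nonneg' hderiv hnonneg hlim)
    ((ae_restrict_mem measurableSet_Ioi).mono hnonneg),
    integral_Ioi_of_hasDerivAt_of_nonneg' hderiv hnonneg hlim]
  congr 1
  ring

lemma lintegral_Ioo_mul_id {b c : ℝ} (hb : 0 ≤ b) (hc : 0 ≤ c) :
    ∫⁻ t in Set.Ioo 0 b, ENNReal.ofReal (2 * t * c) = ENNReal.ofReal (b ^ 2 * c) := by
  have hcont : Continuous fun t : ℝ => 2 * t * c := by fun_prop
  rw [← ofReal_integral_eq_lintegral_ofReal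
    (hcont.integrableOn_Icc.mono_set Set.Ioo_subset_Icc_self)
    ((ae_restrict_mem measurableSet_Ioo).mono fun t ht => by
      have := ht.1
      show 0 ≤ 2 * t * c
      positivity),
    ← integral_Ioc_eq_integral_Ioo, ← intervalIntegral.integral_of_le hb]
  rw [intervalIntegral.integral_mul_const, intervalIntegral.integral_const_mul, integral_id]
  congr 1
  ring

lemma lintegral_Ioi_sq_mul_exp_neg_mul {r : ℝ} (hr : 0 < r) :
    ∫⁻ x in Set.Ioi (0 : ℝ), ENNReal.ofReal (x ^ 2 * Real.exp (-(r * x)))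
      = ENNReal.ofReal (2 * (1 / r ^ 3)) := by
  have hint := Real.integral_rpow_mul_exp_neg_mul_Ioi (a := 3) (by norm_num) hr
  have hΓ : Real.Gamma 3 = 2 := by
    rw [show (3 : ℝ) = (2 : ℕ) + 1 by norm_num, Real.Gamma_nat_eq_factorial]
    norm_num
  have heq : ∫ x in Set.Ioi (0 : ℝ), x ^ 2 * Real.exp (-(r * x)) = 2 * (1 / r ^ 3) := by
    rw [hΓ] at hint
    norm_num at hint
    rw [hint]
    simp [mul_comm]
  rw [← ofReal_integral_eq_lintegral_ofReal, heq]
  · by_contra h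
    rw [← IntegrableOn] at h
    have h0 := integral_undef h
    rw [heq] at h0
    have : 0 < 2 * (1 / r ^ 3) := by positivity
    linarith
  · exact .of_forall fun x => by positivity

lemma lintegral_Ioi_sq_mul_exp_neg_div_one_sub_exp_neg :
    ∫⁻ x in Set.Ioi (0 : ℝ),
        ENNReal.ofReal (x ^ 2 * (Real.exp (-x) / (1 - Real.exp (-x))))
      = ENNReal.ofReal (2 * ∑' n : ℕ, (1 : ℝ) / (n + 1) ^ 3) := by
  have hsum : Summable fun n : ℕ => (1 : ℝ) / (n + 1) ^ 3 := by
    have := (summable_nat_add_iff 1).2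
      (Real.summable_one_div_nat_pow.2 (show 1 < 3 by norm_num))
    simpa using this
  rw [← tsum_mul_left, ENNReal.ofReal_tsum_of_nonneg (fun n => by positivity)
    (hsum.mul_left 2)]
  have hterm : ∀ n : ℕ, ENNReal.ofReal (2 * (1 / ((n : ℝ) + 1) ^ 3))
      = ∫⁻ x in Set.Ioi (0 : ℝ), ENNReal.ofReal (x ^ 2 * Real.exp (-(((n : ℝ) + 1) * x))) :=
    fun n => (lintegral_Ioi_sq_mul_exp_neg_mul (by positivity)).symm
  simp_rw [hterm]
  rw [← lintegral_tsum fun n => by fun_prop]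
  refine setLIntegral_congr_fun measurableSet_Ioi fun x (hx : 0 < x) => ?_
  have hgeom := (hasSum_geometric_of_lt_one (Real.exp_pos (-x)).le
    (Real.exp_lt_one_iff.2 (by linarith))).mul_left (x ^ 2 * Real.exp (-x))
  have hpow : ∀ n : ℕ, x ^ 2 * Real.exp (-(((n : ℝ) + 1) * x))
      = x ^ 2 * Real.exp (-x) * Real.exp (-x) ^ n := by
    intro n
    rw [← Real.exp_nat_mul, mul_assoc, ← Real.exp_add]
    ring_nf
  simp only [hpow]
  rw [← ENNReal.ofReal_tsum_of_nonneg (fun n => by positivity) hgeom.summable, hgeom.tsum_eq,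
    div_eq_mul_inv, mul_assoc]

/-- With `ρ₁` the Erdős–Rényi giant-component function (`ρ₁ t = 0` for `t ≤ 1`
and `ρ₁ t` the unique positive root of `ρ = 1 − e^{−tρ}` for `t > 1`),
`(1/2) ∫_0^∞ (1 − ρ₁(t)²) t dt = ζ(3) = ∑_{n≥1} 1/n³`. -/
theorem stmt16 (ρ : ℝ → ℝ)
    (hzero : ∀ t : ℝ, t ≤ 1 → ρ t = 0)
    (hpos : ∀ t : ℝ, 1 < t → 0 < ρ t)
    (hlt : ∀ t : ℝ, 1 < t → ρ t < 1)
    (hfix : ∀ t : ℝ, 1 < t → ρ t = 1 - Real.exp (-(t * ρ t)))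
    (huniq : ∀ t : ℝ, 1 < t → ∀ y : ℝ, 0 < y → y = 1 - Real.exp (-(t * y)) → y = ρ t) :
    (1 / 2) * ∫ t in Set.Ioi (0 : ℝ), (1 - ρ t ^ 2) * t
      = ∑' n : ℕ, (1 : ℝ) / (n + 1) ^ 3 := by
  have hparam := exists_giantComponent_eq_one_sub_exp_neg hzero hpos hfix
  have hmeas := measurable_giantComponent hparam
  let S : Set (ℝ × ℝ) := {p | p.1 * (1 - Real.exp (-p.2)) < p.2}
  have hS : MeasurableSet S := measurableSet_lt (by fun_prop) measurable_snd
  let F : ℝ × ℝ → ENNReal := S.indicator fun p =>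
    ENNReal.ofReal (2 * p.1 * ((1 - Real.exp (-p.2)) * Real.exp (-p.2)))
  have hF : Measurable F := Measurable.indicator (by fun_prop) hS
  have hleft : ∀ t ∈ Set.Ioi (0 : ℝ),
      ENNReal.ofReal ((1 - ρ t ^ 2) * t) = ∫⁻ x in Set.Ioi (0 : ℝ), F (t, x) := by
    intro t (ht : 0 < t)
    obtain ⟨a, ha, h, hx⟩ := hparam t
    rw [h, ← lintegral_Ioi_one_sub_exp_neg_mul_exp_neg ha ht.le,
      ← Set.inter_eq_self_of_subset_left (Set.Ioi_subset_Ioi ha),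
      ← setLIntegral_indicator measurableSet_Ioi]
    refine setLIntegral_congr_fun measurableSet_Ioi fun x (h0 : 0 < x) => ?_
    simp only [F, S, Set.indicator_apply, Set.mem_ofPred_eq, Set.mem_Ioi, hx x h0]
  have hright : ∀ x ∈ Set.Ioi (0 : ℝ), ∫⁻ t in Set.Ioi (0 : ℝ), F (t, x)
      = ENNReal.ofReal (x ^ 2 * (Real.exp (-x) / (1 - Real.exp (-x)))) := by
    intro x (hx : 0 < x)
    have hc := one_sub_exp_neg_pos hx
    trans ∫⁻ t in Set.Ioo 0 (x / (1 - Real.exp (-x))),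
      ENNReal.ofReal (2 * t * ((1 - Real.exp (-x)) * Real.exp (-x)))
    · rw [← Set.Iio_inter_Ioi, ← setLIntegral_indicator measurableSet_Iio]
      refine lintegral_congr fun t => ?_
      simp only [F, S, Set.indicator_apply, Set.mem_ofPred_eq, Set.mem_Iio, lt_div_iff₀ hc]
    · rw [lintegral_Ioo_mul_id (by positivity) (by positivity)]
      congr 1
      field_simp
  have hkey : ∫⁻ t in Set.Ioi (0 : ℝ), ENNReal.ofReal ((1 - ρ t ^ 2) * t)
      = ENNReal.ofReal (2 * ∑' n : ℕ, (1 : ℝ) / (n + 1) ^ 3) := by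
    rw [setLIntegral_congr_fun measurableSet_Ioi hleft,
      lintegral_lintegral_swap (f := fun t x => F (t, x)) hF.aemeasurable,
      setLIntegral_congr_fun measurableSet_Ioi hright,
      lintegral_Ioi_sq_mul_exp_neg_div_one_sub_exp_neg]
  have hnonneg : ∀ t ∈ Set.Ioi (0 : ℝ), 0 ≤ (1 - ρ t ^ 2) * t := by
    intro t (ht : 0 < t)
    obtain ⟨a, ha, h, -⟩ := hparam t
    have h1 : Real.exp (-a) ≤ 1 := Real.exp_le_one_iff.2 (by linarith)
    have h2 := Real.exp_pos (-a)
    have : 0 ≤ 1 - ρ t ^ 2 := by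
      rw [h]
      nlinarith
    positivity
  rw [integral_eq_lintegral_of_nonneg_ae ((ae_restrict_mem measurableSet_Ioi).mono hnonneg)
    (by fun_prop), hkey, ENNReal.toReal_ofReal]
  · ring
  · exact mul_nonneg (by norm_num) (tsum_nonneg fun n => by positivity)
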